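/- arXiv:1406.4160 — 10 statements merged into one kernel-verified Lean document; each statement's English description precedes it below -/
import Mathlib

section
/- Let m be an even positive integer. Then Q_m(t) > 0 for every real number t ≥ 0. -/
/-- `P m t = ∑_{j=0}^{m} (−1)^j (m+1−j) t^{m−j}`, so `P 0 t = 1`. -/
noncomputable def P (m : ℕ) (t : ℝ) : ℝ :=
  ∑ j ∈ Finset.range (m + 1), (-1 : ℝ) ^ j * ((m + 1 - j : ℕ) : ℝ) * t ^ (m - j)

/-- `Q m t = P m t − P (m−1) t` (for `m ≥ 1`). -/
noncomputable def Q (m : ℕ) (t : ℝ) : ℝ := P m t - P (m - 1) t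

theorem P_rec (m : ℕ) (t : ℝ) : P (m + 1) t = (m + 2) * t ^ (m + 1) - P m t := by
  unfold P
  rw [Finset.sum_range_succ']
  have h : ∀ j ∈ Finset.range (m + 1),
      (-1 : ℝ) ^ (j + 1) * ((m + 1 + 1 - (j + 1) : ℕ) : ℝ) * t ^ (m + 1 - (j + 1))
      = -((-1 : ℝ) ^ j * ((m + 1 - j : ℕ) : ℝ) * t ^ (m - j)) := by
    intro j _
    rw [Nat.add_sub_add_right, Nat.add_sub_add_right]
    ring
  rw [Finset.sum_congr rfl h, Finset.sum_neg_distrib]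
  simp only [Nat.sub_zero]
  push_cast
  ring

theorem P_closed (m : ℕ) (t : ℝ) :
    (1 + t) ^ 2 * P m t = (m + 1) * t ^ (m + 2) + (m + 2) * t ^ (m + 1) + (-1) ^ m := by
  induction m with
  | zero => simp [P]; ring
  | succ n ih =>
    rw [P_rec, mul_sub, ih]
    push_cast
    ring

theorem amgm_aux (p : ℕ) (x : ℝ) (hx : 0 ≤ x) :
    0 ≤ 1 + p * x ^ (p + 1) - (p + 1) * x ^ p := by
  induction p with
  | zero => simp
  | succ n ih =>
    have h1 : 0 ≤ (1 - x) * (1 - x ^ (n + 1)) := by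
      rcases le_total x 1 with h | h
      · exact mul_nonneg (by linarith) (by linarith [pow_le_one₀ hx h (n := n + 1)])
      · exact mul_nonneg_of_nonpos_of_nonpos (by linarith)
          (by linarith [one_le_pow₀ h (n := n + 1)])
    have h2 := mul_nonneg hx ih
    have : (1 : ℝ) + ((n + 1 : ℕ) : ℝ) * x ^ (n + 1 + 1) - (((n + 1 : ℕ) : ℝ) + 1) * x ^ (n + 1)
      = x * (1 + n * x ^ (n + 1) - (n + 1) * x ^ n) + (1 - x) * (1 - x ^ (n + 1)) := by
      push_cast
      ring
    rw [this]
    exact add_nonneg h2 h1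

theorem Q_pos_of_even (m : ℕ) (hm : 0 < m) (hme : Even m) :
    ∀ t : ℝ, 0 ≤ t → 0 < Q m t := by
  intro t ht
  obtain ⟨n, rfl⟩ : ∃ n, m = n + 1 := ⟨m - 1, by omega⟩
  obtain ⟨p, hp⟩ := hme
  have hodd : (-1 : ℝ) ^ n = -1 := Odd.neg_one_pow ⟨p - 1, by omega⟩
  have hc := P_closed n t
  rw [hodd] at hc
  have hnp : (n : ℝ) = 2 * p - 1 := by
    have : ((n + 1 : ℕ) : ℝ) = ((p + p : ℕ) : ℝ) := by rw [hp]
    push_cast at this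
    linarith
  have hpow : t ^ (n + 1) = (t ^ 2) ^ p := by rw [← pow_mul]; congr 1; omega
  have hpow2 : t ^ (n + 2) = (t ^ 2) ^ p * t := by rw [pow_succ, hpow]
  rw [hpow, hpow2, hnp] at hc
  have hQ : (1 + t) ^ 2 * Q (n + 1) t
      = 2 * (1 + p * (t ^ 2) ^ (p + 1) - (p + 1) * (t ^ 2) ^ p)
        + (t ^ 2) ^ p * (1 + 2 * t + t ^ 2) := by
    unfold Q
    rw [Nat.add_sub_cancel, P_rec, hpow, hnp]
    linear_combination (-2) * hc
  have ha := amgm_aux p (t ^ 2) (by positivity)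
  have hpos : 0 < (1 + t) ^ 2 * Q (n + 1) t := by
    rcases ht.eq_or_lt with h | h
    · subst h
      have hp0 : p ≠ 0 := by omega
      rw [hQ]
      simp [hp0]
    · rw [hQ]
      have : 0 < (t ^ 2) ^ p * (1 + 2 * t + t ^ 2) := by positivity
      linarith
  exact pos_of_mul_pos_right hpos (by positivity)
end

section
/- Let m be an even positive integer. Then Q_m(t) ≥ 4(m+1) / ((m+2)^2 (t+1)^2) for every real number t ≥ 0. -/
theorem P_succ_aux (m : ℕ) (t : ℝ) : P (m + 1) t = ((m : ℝ) + 2) * t ^ (m + 1) - P m t := by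
  unfold P
  rw [Finset.sum_range_succ', add_comm, sub_eq_add_neg, ← Finset.sum_neg_distrib]
  congr 1
  · simp
    left
    ring
  · apply Finset.sum_congr rfl
    intro j _
    rw [Nat.add_sub_add_right, Nat.add_sub_add_right, pow_succ]
    ring

theorem P_closed_aux (m : ℕ) (t : ℝ) :
    (t + 1) ^ 2 * P m t = ((m : ℝ) + 1) * t ^ (m + 2) + ((m : ℝ) + 2) * t ^ (m + 1) + (-1) ^ m := by
  induction m with
  | zero => simp [P]; ring
  | succ k ih =>
    rw [P_succ_aux, mul_sub, ih]
    push_cast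
    ring

theorem bern_aux (n : ℕ) (u : ℝ) (h0 : 0 ≤ u) (h1 : u ≤ 1) :
    (2 * (n : ℝ) + 1) * u ^ n * (1 - u) ≤ 1 - u ^ (2 * n + 1) := by
  induction n with
  | zero => simp
  | succ k ih =>
    have b1 := one_add_mul_le_pow (a := u - 1) (by linarith) (k + 1)
    have b2 := one_add_mul_le_pow (a := u - 1) (by linarith) (k + 2)
    rw [add_sub_cancel] at b1 b2
    push_cast at b1 b2 ⊢
    have hy : 0 ≤ u ^ k * (1 - u) := mul_nonneg (pow_nonneg h0 k) (by linarith)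
    have b3 : 0 ≤ u ^ (k + 1) + u ^ (k + 2) + (2 * k + 1) - (2 * k + 3) * u := by linarith
    have b4 := mul_nonneg hy b3
    have e : (1 - u ^ (2 * (k + 1) + 1) - (2 * ((k : ℝ) + 1) + 1) * u ^ (k + 1) * (1 - u)) -
        (1 - u ^ (2 * k + 1) - (2 * (k : ℝ) + 1) * u ^ k * (1 - u)) =
        u ^ k * (1 - u) * (u ^ (k + 1) + u ^ (k + 2) + (2 * k + 1) - (2 * k + 3) * u) := by ring
    linarith

theorem Q_lower_bound_of_even (m : ℕ) (hm : 0 < m) (hme : Even m) :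
    ∀ t : ℝ, 0 ≤ t →
      Q m t ≥ 4 * ((m : ℝ) + 1) / (((m : ℝ) + 2) ^ 2 * (t + 1) ^ 2) := by
  intro t ht
  obtain ⟨n, hn⟩ := hme
  obtain ⟨k, rfl⟩ : ∃ k, n = k + 1 := ⟨n - 1, by omega⟩
  obtain rfl : m = (2 * k + 1) + 1 := by omega
  have hQ : (t + 1) ^ 2 * Q ((2 * k + 1) + 1) t =
      2 + 2 * t ^ (2 * k + 3) - (2 * (k : ℝ) + 3) * (t ^ 2) ^ (k + 1) * (1 - t ^ 2) := by
    unfold Q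
    rw [Nat.add_sub_cancel, mul_sub, P_closed_aux, P_closed_aux,
      Even.neg_one_pow (n := 2 * k + 1 + 1) ⟨k + 1, by ring⟩,
      Odd.neg_one_pow (n := 2 * k + 1) ⟨k, rfl⟩]
    push_cast
    ring
  have hb : (2 * (k : ℝ) + 3) * (t ^ 2) ^ (k + 1) * (1 - t ^ 2) ≤ 1 := by
    by_cases h : t ^ 2 ≤ 1
    · have h2 := bern_aux (k + 1) (t ^ 2) (by positivity) h
      have h3 : 0 ≤ (t ^ 2) ^ (2 * (k + 1) + 1) := by positivity
      push_cast at h2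
      have e : 2 * ((k : ℝ) + 1) + 1 = 2 * k + 3 := by ring
      rw [e] at h2
      linarith
    · have h3 : 0 ≤ (2 * (k : ℝ) + 3) * (t ^ 2) ^ (k + 1) := by positivity
      have := mul_nonneg h3 (show 0 ≤ t ^ 2 - 1 by linarith)
      linarith
  have hp : 0 ≤ t ^ (2 * k + 3) := by positivity
  have hq : 1 ≤ (t + 1) ^ 2 * Q ((2 * k + 1) + 1) t := by linarith
  have hk : (0 : ℝ) ≤ k := Nat.cast_nonneg k
  rw [ge_iff_le, div_le_iff₀ (by positivity)]
  push_cast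
  have h5 := mul_le_mul_of_nonneg_left hq (sq_nonneg (2 * (k : ℝ) + 1 + 1 + 2))
  nlinarith
end

section
/- Suppose n ≥ 3 is odd and d ≥ σ_1(ω) + 1. Then the derivative of Ψ satisfies Ψ'(t) > σ_{n−1}(ω) for every real number t ≥ 0; in particular Ψ'(t) > 0 for all t ≥ 0. -/
/-- The `k`-th elementary symmetric function of the (real values of) `ω : Fin N → ℕ`,
with `esym ω 0 = 1`. -/
noncomputable def esym {N : ℕ} (ω : Fin N → ℕ) (k : ℕ) : ℝ :=
  ∑ A ∈ Finset.powersetCard k (Finset.univ : Finset (Fin N)), ∏ i ∈ A, (ω i : ℝ)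

/-- `Ψ(t) = ∑_{j=0}^{n−1} ( ∑_{k=0}^{j} (−1)^k σ_{j−k}(ω) t^{k+1} ) (d−1)^{n−1−j}`
for weights `ω_0, …, ω_n`. -/
noncomputable def Psi (n : ℕ) (ω : Fin (n + 1) → ℕ) (d : ℤ) (t : ℝ) : ℝ :=
  ∑ j ∈ Finset.range n,
    (∑ k ∈ Finset.range (j + 1), (-1 : ℝ) ^ k * esym ω (j - k) * t ^ (k + 1)) *
      ((d : ℝ) - 1) ^ (n - 1 - j)

def aSeq (D t : ℝ) : ℕ → ℝ
  | 0 => 1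
  | (m + 1) => D * aSeq D t m + ((m : ℝ) + 2) * (-t) ^ (m + 1)

lemma aSeq_closed (D t : ℝ) (m : ℕ) :
    (D + t) ^ 2 * aSeq D t m
      = D ^ (m + 2) - (-t) ^ (m + 1) * (((m : ℝ) + 2) * D + ((m : ℝ) + 1) * t) := by
  induction m with
  | zero => simp [aSeq]; ring
  | succ m ih =>
    have : (D + t) ^ 2 * aSeq D t (m + 1)
      = D * ((D + t) ^ 2 * aSeq D t m) + (D + t) ^ 2 * (((m : ℝ) + 2) * (-t) ^ (m + 1)) := by
      simp only [aSeq]; ring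
    rw [this, ih]; push_cast; ring

lemma bern (D t : ℝ) (ht : 0 ≤ t) (h : t ≤ D) (m : ℕ) :
    ((m : ℝ) + 1) * t ^ m * (D - t) ≤ D ^ (m + 1) - t ^ (m + 1) := by
  induction m with
  | zero => simp
  | succ m ih =>
    have h1 := mul_le_mul_of_nonneg_left ih ht
    have h2 : 0 ≤ D ^ (m + 1) * (D - t) - t ^ (m + 1) * (D - t) := by
      rw [← sub_mul]
      exact mul_nonneg (sub_nonneg.2 (pow_le_pow_left₀ ht h _)) (sub_nonneg.2 h)
    have h3 : 0 ≤ D ^ (m + 1) * (D - t) := mul_nonneg (pow_nonneg (ht.trans h) _) (sub_nonneg.2 h)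
    push_cast
    ring_nf at h1 h2 h3 ⊢
    linarith

lemma aSeq_even_pos (D t : ℝ) (hD : 0 < D) (ht : 0 ≤ t) (q : ℕ) :
    0 < aSeq D t (2 * q) := by
  have h := aSeq_closed D t (2 * q)
  rw [Odd.neg_pow ⟨q, rfl⟩] at h
  have h2 : 0 < (D + t) ^ 2 * aSeq D t (2 * q) := by
    rw [h, neg_mul, sub_neg_eq_add]; positivity
  exact pos_of_mul_pos_right h2 (by positivity)

lemma aSeq_pair_pos (D t : ℝ) (hD : 0 < D) (ht : 0 ≤ t) (q : ℕ) :
    0 < aSeq D t (2 * q + 2) + D * aSeq D t (2 * q + 1) := by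
  have h := aSeq_closed D t (2 * q + 2)
  have h' := aSeq_closed D t (2 * q + 1)
  rw [Odd.neg_pow ⟨q + 1, by ring⟩] at h
  rw [Even.neg_pow ⟨q + 1, by ring⟩] at h'
  have h2 : 0 < (D + t) ^ 2 * (aSeq D t (2 * q + 2) + D * aSeq D t (2 * q + 1)) := by
    have e : (D + t) ^ 2 * (aSeq D t (2 * q + 2) + D * aSeq D t (2 * q + 1))
      = 2 * D ^ (2 * q + 4) + 2 * D * t ^ (2 * q + 3)
        + (2 * (q : ℝ) + 3) * t ^ (2 * q + 2) * (t - D) * (t + D) := by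
      rw [mul_add, h, mul_left_comm, h']; push_cast; ring
    rw [e]
    rcases le_or_gt D t with hl | hl
    · have : 0 ≤ t - D := sub_nonneg.2 hl
      positivity
    · have b := bern D t ht hl.le (2 * q + 2)
      have b2 := mul_le_mul_of_nonneg_right b (add_nonneg ht hD.le)
      have h3 : 0 < D ^ (2 * q + 3) * (D - t) := mul_pos (by positivity) (sub_pos.2 hl)
      have h4 : 0 ≤ 3 * D * t ^ (2 * q + 3) + t ^ (2 * q + 4) := by positivity
      push_cast at b2
      ring_nf at b2 h3 h4 ⊢
      linarith
  exact pos_of_mul_pos_right h2 (by positivity)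

lemma pair_id (D x y A B : ℝ) : D * (x * A + y * B) = (D * x - y) * A + y * (A + D * B) := by ring

lemma pair_nonneg (D t x y : ℝ) (hD : 0 < D) (ht : 0 ≤ t) (q : ℕ) (hy : 0 ≤ y)
    (hxy : y ≤ D * x) : 0 ≤ x * aSeq D t (2 * q + 2) + y * aSeq D t (2 * q + 1) := by
  have h1 := aSeq_even_pos D t hD ht (q + 1)
  have h2 := aSeq_pair_pos D t hD ht q
  have h3 := pair_id D x y (aSeq D t (2 * q + 2)) (aSeq D t (2 * q + 1))
  refine nonneg_of_mul_nonneg_right (a := D) ?_ hD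
  rw [h3]
  exact add_nonneg (mul_nonneg (sub_nonneg.2 hxy) h1.le) (mul_nonneg hy h2.le)

lemma pair_pos (D t x y : ℝ) (hD : 0 < D) (ht : 0 ≤ t) (q : ℕ) (hy : 0 < y)
    (hxy : y ≤ D * x) : 0 < x * aSeq D t (2 * q + 2) + y * aSeq D t (2 * q + 1) := by
  have h1 := aSeq_even_pos D t hD ht (q + 1)
  have h2 := aSeq_pair_pos D t hD ht q
  have h3 := pair_id D x y (aSeq D t (2 * q + 2)) (aSeq D t (2 * q + 1))
  refine pos_of_mul_pos_right (a := D) ?_ hD.le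
  rw [h3]
  exact add_pos_of_nonneg_of_pos (mul_nonneg (sub_nonneg.2 hxy) h1.le) (mul_pos hy h2)

lemma sum_step (D t : ℝ) (q : ℕ) (e : ℕ → ℝ) :
    ∑ i ∈ Finset.range (2 * (q + 1) + 1), e i * aSeq D t (2 * (q + 1) - i)
    = ∑ i ∈ Finset.range (2 * q + 1), e (i + 2) * aSeq D t (2 * q - i)
      + (e 0 * aSeq D t (2 * q + 2) + e 1 * aSeq D t (2 * q + 1)) := by
  rw [show 2 * (q + 1) + 1 = 2 * q + 1 + 1 + 1 by ring, Finset.sum_range_succ',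
    Finset.sum_range_succ']
  have : ∀ i, 2 * (q + 1) - (i + 1 + 1) = 2 * q - i := fun i => by omega
  simp only [this]
  have h1 : 2 * (q + 1) - (0 + 1) = 2 * q + 1 := by omega
  rw [h1]
  simp only [zero_add, Nat.sub_zero, mul_add, mul_one]
  ring

lemma sum_ge (D t : ℝ) (hD : 0 < D) (ht : 0 ≤ t) (q : ℕ) : ∀ (e : ℕ → ℝ),
    (∀ i, 0 ≤ e i) → (∀ i, e (i + 1) ≤ D * e i) →
    e (2 * q) ≤ ∑ i ∈ Finset.range (2 * q + 1), e i * aSeq D t (2 * q - i) := by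
  induction q with
  | zero => intro e _ _; simp [aSeq]
  | succ q ih =>
    intro e h0 h1
    rw [sum_step]
    have := ih (fun i => e (i + 2)) (fun i => h0 _) (fun i => h1 _)
    have h2 := pair_nonneg D t (e 0) (e 1) hD ht q (h0 1) (h1 0)
    simp only [mul_add, mul_one] at this ⊢
    linarith

lemma sum_gt (D t : ℝ) (hD : 0 < D) (ht : 0 ≤ t) (q : ℕ) (e : ℕ → ℝ)
    (h0 : ∀ i, 0 ≤ e i) (h1 : ∀ i, e (i + 1) ≤ D * e i) (hp : 0 < e 1) :
    e (2 * (q + 1)) < ∑ i ∈ Finset.range (2 * (q + 1) + 1),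
      e i * aSeq D t (2 * (q + 1) - i) := by
  rw [sum_step]
  have := sum_ge D t hD ht q (fun i => e (i + 2)) (fun i => h0 _) (fun i => h1 _)
  have h2 := pair_pos D t (e 0) (e 1) hD ht q hp (h1 0)
  simp only [mul_add, mul_one] at this ⊢
  linarith

lemma rearr (D t : ℝ) (e : ℕ → ℝ) (N : ℕ) :
    ∑ j ∈ Finset.range (N + 1),
      (∑ k ∈ Finset.range (j + 1), (-1 : ℝ) ^ k * e (j - k) * (((k : ℝ) + 1) * t ^ k)) *
        D ^ (N - j)
    = ∑ i ∈ Finset.range (N + 1), e i * aSeq D t (N - i) := by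
  induction N with
  | zero => simp [aSeq]
  | succ N ih =>
    rw [Finset.sum_range_succ]
    have h1 : ∑ j ∈ Finset.range (N + 1),
      (∑ k ∈ Finset.range (j + 1), (-1 : ℝ) ^ k * e (j - k) * (((k : ℝ) + 1) * t ^ k)) *
        D ^ (N + 1 - j) = D * ∑ i ∈ Finset.range (N + 1), e i * aSeq D t (N - i) := by
      rw [← ih, Finset.mul_sum]
      refine Finset.sum_congr rfl fun j hj => ?_
      have : N + 1 - j = N - j + 1 := by have := Finset.mem_range.1 hj; omega
      rw [this, pow_succ]; ring
    rw [h1, ← Finset.sum_range_reflect (n := N + 1 + 1)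
      (fun k => (-1 : ℝ) ^ k * e (N + 1 - k) * (((k : ℝ) + 1) * t ^ k)),
      Nat.sub_self, pow_zero, mul_one, Finset.sum_range_succ _ (N + 1),
      Finset.sum_range_succ _ (N + 1), ← add_assoc, Finset.mul_sum, ← Finset.sum_add_distrib]
    congr 1
    · refine Finset.sum_congr rfl fun i hi => ?_
      have hi' := Finset.mem_range.1 hi
      obtain ⟨m, rfl⟩ : ∃ m, N = i + m := ⟨N - i, by omega⟩
      rw [show i + m - i = m by omega, show i + m + 1 + 1 - 1 - i = m + 1 by omega,
        show i + m + 1 - (m + 1) = i by omega, show i + m + 1 - i = m + 1 by omega]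
      simp only [aSeq]
      rw [neg_pow t]
      push_cast; ring
    · simp [aSeq]

lemma deriv_Psi_eq (n : ℕ) (ω : Fin (n + 1) → ℕ) (d : ℤ) (t : ℝ) :
    deriv (Psi n ω d) t = ∑ j ∈ Finset.range n,
    (∑ k ∈ Finset.range (j + 1), (-1 : ℝ) ^ k * esym ω (j - k) * (((k : ℝ) + 1) * t ^ k)) *
      ((d : ℝ) - 1) ^ (n - 1 - j) := by
  refine HasDerivAt.deriv ?_
  unfold Psi
  refine HasDerivAt.fun_sum fun j _ => HasDerivAt.mul_const (HasDerivAt.fun_sum fun k _ => ?_) _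
  have := (hasDerivAt_pow (k + 1) t).const_mul ((-1 : ℝ) ^ k * esym ω (j - k))
  simpa using this

noncomputable def es {ι : Type*} (f : ι → ℝ) (s : Finset ι) (k : ℕ) : ℝ :=
  ∑ A ∈ Finset.powersetCard k s, ∏ i ∈ A, f i

lemma es_nonneg {ι : Type*} (f : ι → ℝ) (hf : ∀ i, 0 ≤ f i) (s : Finset ι) (k : ℕ) :
    0 ≤ es f s k := Finset.sum_nonneg fun _ _ => Finset.prod_nonneg fun i _ => hf i

lemma es_insert {ι : Type*} [DecidableEq ι] (f : ι → ℝ) (s : Finset ι) (a : ι) (ha : a ∉ s)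
    (k : ℕ) : es f (insert a s) (k + 1) = es f s (k + 1) + f a * es f s k := by
  unfold es
  have hm : ∀ A ∈ Finset.powersetCard k s, a ∉ A := fun A hA h =>
    ha ((Finset.mem_powersetCard.1 hA).1 h)
  rw [Finset.powersetCard_succ_insert ha, Finset.sum_union, Finset.sum_image, Finset.mul_sum]
  · congr 1
    exact Finset.sum_congr rfl fun A hA => Finset.prod_insert (hm A hA)
  · intro A hA B hB h
    rw [← Finset.erase_insert (hm A hA), ← Finset.erase_insert (hm B hB), h]
  · rw [Finset.disjoint_left]
    intro A hA hB
    obtain ⟨B, _, rfl⟩ := Finset.mem_image.1 hB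
    exact ha ((Finset.mem_powersetCard.1 hA).1 (Finset.mem_insert_self a B))

lemma es_le {ι : Type*} [DecidableEq ι] (f : ι → ℝ) (hf : ∀ i, 0 ≤ f i) (s : Finset ι) :
    ∀ k, es f s (k + 1) ≤ es f s 1 * es f s k := by
  have z : ∀ s : Finset ι, es f s 0 = 1 := fun s => by simp [es]
  induction s using Finset.induction_on with
  | empty =>
    intro k
    have : ∀ k, es f ∅ (k + 1) = 0 := fun k => by
      unfold es; rw [Finset.powersetCard_eq_empty.2 (by simp)]; simp
    rw [this k, this 0]; simp
  | insert a s ha ih =>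
    intro k
    cases k with
    | zero => simp [z]
    | succ k =>
      have h1 := es_insert f s a ha 0
      rw [z] at h1
      rw [es_insert f s a ha (k + 1), es_insert f s a ha k, h1]
      have := ih (k + 1)
      have a0 := hf a
      have p1 := mul_nonneg (mul_nonneg a0 (es_nonneg f hf s 1)) (es_nonneg f hf s k)
      have p2 := mul_nonneg (mul_nonneg a0 a0) (es_nonneg f hf s k)
      simp only [zero_add] at *
      nlinarith

theorem deriv_Psi_pos_of_odd (n : ℕ) (hn : 3 ≤ n) (hodd : Odd n)
    (ω : Fin (n + 1) → ℕ) (hω : ∀ i, 0 < ω i)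
    (d : ℤ) (hd : (d : ℝ) ≥ esym ω 1 + 1) :
    ∀ t : ℝ, 0 ≤ t →
      deriv (Psi n ω d) t > esym ω (n - 1) ∧ deriv (Psi n ω d) t > 0 := by
  intro t ht
  have hf : ∀ i, 0 ≤ (fun i => (ω i : ℝ)) i := fun i => Nat.cast_nonneg _
  have h0 : ∀ k, 0 ≤ esym ω k := fun k => es_nonneg _ hf _ k
  have hle : ∀ k, esym ω (k + 1) ≤ esym ω 1 * esym ω k := fun k => es_le _ hf _ k
  have hp : 0 < esym ω 1 := by
    unfold esym
    refine Finset.sum_pos (fun A _ => Finset.prod_pos fun i _ => Nat.cast_pos.2 (hω i)) ?_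
    exact Finset.powersetCard_nonempty.2 (by simp)
  have hD : esym ω 1 ≤ (d : ℝ) - 1 := by linarith
  have key : esym ω (n - 1) < deriv (Psi n ω d) t := by
    rw [deriv_Psi_eq]
    obtain ⟨p, rfl⟩ := hodd
    obtain ⟨q, rfl⟩ : ∃ q, p = q + 1 := ⟨p - 1, by omega⟩
    simp only [Nat.add_sub_cancel]
    rw [rearr]
    exact sum_gt _ t (hp.trans_le hD) ht q _ h0
      (fun i => (hle i).trans (mul_le_mul_of_nonneg_right hD (h0 i))) hp
  exact ⟨key, (h0 _).trans_lt key⟩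
end

section
/- Suppose d ≥ 2. Then for every real number t one has Ψ'(t) = Σ_{l=0}^{n−1} σ_l(ω) (−1)^{n−1−l} (d−1)^{n−1−l} P_{n−1−l}( t/(d−1) ). -/
theorem deriv_Psi_eq_sum_P (n : ℕ) (hn : 2 ≤ n) (ω : Fin (n + 1) → ℕ) (hω : ∀ i, 0 < ω i)
    (d : ℤ) (hd : 2 ≤ d) :
    ∀ t : ℝ, deriv (Psi n ω d) t
      = ∑ l ∈ Finset.range n, esym ω l * (-1 : ℝ) ^ (n - 1 - l) * ((d : ℝ) - 1) ^ (n - 1 - l) *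
          P (n - 1 - l) (t / ((d : ℝ) - 1)) := by
  intro t
  have hc : ((d : ℝ) - 1) ≠ 0 := by
    have : (2 : ℝ) ≤ d := by exact_mod_cast hd
    linarith
  have hder : HasDerivAt (Psi n ω d) (∑ j ∈ Finset.range n,
      (∑ k ∈ Finset.range (j + 1), (-1 : ℝ) ^ k * esym ω (j - k) * (((k + 1 : ℕ) : ℝ) * t ^ k)) *
      ((d : ℝ) - 1) ^ (n - 1 - j)) t := by
    unfold Psi
    apply HasDerivAt.fun_sum
    intro j _
    apply HasDerivAt.mul_const
    apply HasDerivAt.fun_sum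
    intro k _
    apply HasDerivAt.const_mul
    simpa using hasDerivAt_pow (k + 1) t
  rw [hder.deriv]
  unfold P
  simp only [Finset.sum_mul, Finset.mul_sum]
  rw [Finset.sum_sigma', Finset.sum_sigma']
  refine Finset.sum_nbij' (fun x => ⟨x.1 - x.2, n - 1 - x.1⟩)
    (fun y => ⟨n - 1 - y.2, n - 1 - y.2 - y.1⟩) ?_ ?_ ?_ ?_ ?_
  · rintro ⟨j, k⟩ h
    simp only [Finset.mem_sigma, Finset.mem_range] at h ⊢
    omega
  · rintro ⟨j, k⟩ h
    simp only [Finset.mem_sigma, Finset.mem_range] at h ⊢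
    omega
  · rintro ⟨j, k⟩ h
    simp only [Finset.mem_sigma, Finset.mem_range] at h
    simp only [Sigma.mk.injEq, heq_eq_eq]
    omega
  · rintro ⟨j, k⟩ h
    simp only [Finset.mem_sigma, Finset.mem_range] at h
    simp only [Sigma.mk.injEq, heq_eq_eq]
    omega
  · rintro ⟨j, k⟩ h
    simp only [Finset.mem_sigma, Finset.mem_range] at h
    obtain ⟨a, rfl⟩ : ∃ a, j = k + a := ⟨j - k, by omega⟩
    obtain ⟨b, rfl⟩ : ∃ b, n = k + a + b + 1 := ⟨n - 1 - (k + a), by omega⟩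
    have e1 : k + a - k = a := by omega
    have e2 : k + a + b + 1 - 1 - (k + a) = b := by omega
    have e3 : k + a + b + 1 - 1 - a = k + b := by omega
    have e4 : k + b + 1 - b = k + 1 := by omega
    have e5 : k + b - b = k := by omega
    simp only [e1, e2, e3, e4, e5]
    have hs : (-1 : ℝ) ^ b * (-1 : ℝ) ^ b = 1 := by
      rw [← mul_pow]; norm_num
    have ht : ((d : ℝ) - 1) ^ k * (t / ((d : ℝ) - 1)) ^ k = t ^ k := by
      rw [← mul_pow, mul_div_cancel₀ _ hc]
    rw [pow_add, pow_add, ← ht]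
    linear_combination (-((-1 : ℝ) ^ k * esym ω a * ((k + 1 : ℕ) : ℝ) * (((d : ℝ) - 1) ^ k *
      (t / ((d : ℝ) - 1)) ^ k) * ((d : ℝ) - 1) ^ b)) * hs
end

section
/- Let n ≥ 3 be an integer and let α > 0 be a real number with α(α+1)^n = 2. Then α > (ln n − ln ln n)/n. -/
theorem root_gt_log_bound (n : ℕ) (hn : 3 ≤ n) (α : ℝ) (hα : 0 < α)
    (hroot : α * (α + 1) ^ n = 2) :
    α > (Real.log n - Real.log (Real.log n)) / n := by
  by_contra! h
  have hn3 : (3 : ℝ) ≤ n := by exact_mod_cast hn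
  have hn0 : (0 : ℝ) < n := by linarith
  have hL : 1 < Real.log n := by
    rw [Real.lt_log_iff_exp_lt hn0]
    linarith [Real.exp_one_lt_d9]
  have hL0 : 0 < Real.log n := by linarith
  have hLL : 0 < Real.log (Real.log n) := Real.log_pos hL
  have h1 : n * α ≤ Real.log n - Real.log (Real.log n) := by
    rw [le_div_iff₀ hn0] at h
    linarith
  have h2 : (α + 1) ^ n ≤ Real.exp (n * α) := by
    rw [Real.exp_nat_mul]
    exact pow_le_pow_left₀ (by linarith) (Real.add_one_le_exp α) n
  have h3 : Real.exp (n * α) ≤ n / Real.log n := by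
    refine (Real.exp_le_exp.mpr h1).trans ?_
    rw [Real.exp_sub, Real.exp_log hn0, Real.exp_log hL0]
  have h4 : α * (α + 1) ^ n ≤ α * (n / Real.log n) :=
    mul_le_mul_of_nonneg_left (h2.trans h3) hα.le
  rw [hroot, ← mul_div_assoc, le_div_iff₀ hL0] at h4
  linarith
end

section
/- Let n ≥ 3 be an integer and let α > 0 be a real number with α(α+1)^n = 2. Then α < ln(2n)/n. -/
theorem root_lt_log_two_n (n : ℕ) (hn : 3 ≤ n) (α : ℝ) (hα : 0 < α)
    (hroot : α * (α + 1) ^ n = 2) :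
    α < Real.log (2 * n) / n := by
  by_contra! hcon
  have hn3 : (3:ℝ) ≤ n := by exact_mod_cast hn
  have hn0 : (0:ℝ) < n := by linarith
  obtain ⟨L, hL⟩ : ∃ L, L = Real.log (2 * n) := ⟨_, rfl⟩
  rw [← hL] at hcon
  have hexp : Real.exp L = 2 * n := by rw [hL, Real.exp_log (by positivity)]
  have hL1 : 1.732 ≤ L := by
    have h1 : Real.log 32 ≤ Real.log ((2 * n) ^ 2) := by
      apply Real.log_le_log (by norm_num)
      nlinarith
    have h2 : Real.log 32 = 5 * Real.log 2 := by
      rw [show (32:ℝ) = 2 ^ 5 by norm_num, Real.log_pow]; norm_num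
    rw [Real.log_pow, ← hL, h2] at h1
    have := Real.log_two_gt_d9
    push_cast at h1
    linarith
  have hL0 : 0 < L := by linarith
  have hm : 1 + L + L ^ 2 / 2 + L ^ 3 / 6 + L ^ 4 / 24 ≤ 2 * n := by
    have := Real.sum_le_exp_of_nonneg hL0.le 5
    rw [hexp] at this
    simp [Finset.sum_range_succ, Nat.factorial] at this
    linarith
  have hb : 0 < L / n := by positivity
  have hle : L / n * (L / n + 1) ^ n ≤ 2 := by
    rw [← hroot]; gcongr
  have hlog := Real.log_le_log (by positivity) hle
  rw [Real.log_mul (by positivity) (by positivity), Real.log_pow,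
    Real.log_div hL0.ne' hn0.ne'] at hlog
  have hLn : L = Real.log 2 + Real.log n := by
    rw [hL, Real.log_mul (by norm_num) hn0.ne']
  have h1 := Real.le_log_one_add_of_nonneg hb.le
  rw [add_comm 1] at h1
  have h2 := mul_le_mul_of_nonneg_left h1 hn0.le
  have h3 : (n:ℝ) * (2 * (L / n) / (L / n + 2)) = L - L ^ 2 / (2 * n + L) := by
    field_simp
    ring
  have h4 := Real.one_sub_inv_le_log_of_pos hL0
  have h5 : 1 - L⁻¹ ≤ L ^ 2 / (2 * n + L) := by linarith
  rw [le_div_iff₀ (by positivity)] at h5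
  have h6 : (L - 1) * (2 * n + L) ≤ L ^ 3 := by
    have := mul_le_mul_of_nonneg_left h5 hL0.le
    have e : L * ((1 - L⁻¹) * (2 * n + L)) = (L - 1) * (2 * n + L) := by
      field_simp
    rw [e] at this
    linarith
  have h7 : (L - 1) * (1 + L + L ^ 2 / 2 + L ^ 3 / 6 + L ^ 4 / 24 + L) ≤ L ^ 3 :=
    le_trans (mul_le_mul_of_nonneg_left (by linarith) (by linarith)) h6
  obtain ⟨t, rfl⟩ : ∃ t, L = t + 1.732 := ⟨L - 1.732, by ring⟩
  have ht : 0 ≤ t := by linarith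
  have : 0 ≤ t ^ 3 := by positivity
  have : 0 ≤ t ^ 4 := by positivity
  have : 0 ≤ t ^ 5 := by positivity
  nlinarith [sq_nonneg t, sq_nonneg (t - 1)]
end

section
/- For every real number ε > 0 there exists an integer N such that for every integer n ≥ N, the unique positive real root α_n of x(x+1)^n = 2 satisfies α_n < (ln n − (1−ε) ln ln n)/n. -/
theorem root_upper_asymptotic :
    ∀ ε : ℝ, 0 < ε → ∃ N : ℕ, ∀ n : ℕ, N ≤ n →
      ∀ α : ℝ, 0 < α → α * (α + 1) ^ n = 2 →
        α < (Real.log n - (1 - ε) * Real.log (Real.log n)) / n := by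
  intro ε hε
  have hc : Filter.Tendsto (fun n : ℕ => (n : ℝ)) Filter.atTop Filter.atTop :=
    tendsto_natCast_atTop_atTop
  have hL : Filter.Tendsto (fun n : ℕ => Real.log (n : ℝ)) Filter.atTop Filter.atTop :=
    Real.tendsto_log_atTop.comp hc
  have hl : Filter.Tendsto (fun n : ℕ => Real.log (Real.log (n : ℝ))) Filter.atTop Filter.atTop :=
    Real.tendsto_log_atTop.comp hL
  have e1 : ∀ᶠ n : ℕ in Filter.atTop, (1 : ℝ) ≤ n := hc.eventually_ge_atTop 1
  have e2 := hL.eventually_ge_atTop 1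
  have e3 := hl.eventually_gt_atTop ((2 * Real.log 2 + 1) / ε)
  have hd : 0 < 1 / (2 * (|1 - ε| + 1)) := by positivity
  have e4 := hL.eventually (Real.isLittleO_log_id_atTop.def hd)
  have e5 := hc.eventually
    ((isLittleO_log_rpow_atTop (by norm_num : (0:ℝ) < 1/2)).def (by norm_num : (0:ℝ) < 1/2))
  obtain ⟨N, hN⟩ := Filter.eventually_atTop.1
    (e1.and (e2.and (e3.and (e4.and e5))))
  refine ⟨N, fun n hn α hα h => ?_⟩
  obtain ⟨h1, h2, h3, h4, h5⟩ := hN n hn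
  by_contra hcon
  push Not at hcon
  simp only [id, Real.norm_eq_abs] at h4 h5
  have hn0 : (0:ℝ) < n := by linarith
  generalize hLdef : Real.log (n:ℝ) = L at *
  generalize hldef : Real.log L = l at *
  have hlε : 2 * Real.log 2 + 1 < ε * l := by
    rw [div_lt_iff₀ hε] at h3; linarith
  have h5' : 4 * L ^ 2 ≤ n := by
    rw [← Real.sqrt_eq_rpow, abs_of_nonneg (Real.sqrt_nonneg _), abs_of_nonneg (by linarith)] at h5
    have := Real.sq_sqrt hn0.le
    nlinarith
  have h6 : |(1 - ε) * l| ≤ L / 2 := by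
    rw [abs_of_nonneg (show (0:ℝ) ≤ L by linarith)] at h4
    rw [abs_mul]
    have hp : 0 < |1 - ε| + 1 := by positivity
    rw [one_div, inv_mul_eq_div, le_div_iff₀ (by positivity)] at h4
    nlinarith [abs_nonneg l]
  have h7 := abs_le.1 h6
  set y := L - (1 - ε) * l with hy
  have hy1 : L / 2 ≤ y := by linarith [h7.2]
  have hy2 : y ≤ 2 * L := by linarith [h7.1]
  have hy0 : 0 < y := by linarith
  have hx0 : 0 < y / n := by positivity
  have hle : y / n * (y / n + 1) ^ n ≤ 2 := by
    rw [← h]; gcongr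
  have hlog := Real.log_le_log (by positivity) hle
  rw [Real.log_mul (by positivity) (by positivity), Real.log_pow,
    Real.log_div hy0.ne' hn0.ne', hLdef] at hlog
  have hb := Real.one_sub_inv_le_log_of_pos (show 0 < y / n + 1 by positivity)
  have hb2 : y / n - (y / n) ^ 2 ≤ 1 - (y / n + 1)⁻¹ := by
    have : 1 - (y / n + 1)⁻¹ - (y / n - (y / n) ^ 2) = (y/n)^3 / (y / n + 1) := by
      generalize y / n = x at *
      field_simp
      ring
    have : 0 ≤ (y/n)^3 / (y / n + 1) := by positivity
    linarith
  have hb3 : y - 1 ≤ n * Real.log (y / n + 1) := by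
    have k1 : n * (y / n - (y / n) ^ 2) ≤ n * Real.log (y / n + 1) := by
      gcongr; linarith
    have k2 : n * (y / n - (y / n) ^ 2) = y - y ^ 2 / n := by field_simp
    have k3 : y ^ 2 / n ≤ 1 := by
      rw [div_le_one hn0]; nlinarith
    linarith
  have hly : l - Real.log 2 ≤ Real.log y := by
    rw [← hldef, ← Real.log_div (by linarith) (by norm_num)]
    exact Real.log_le_log (by linarith) hy1
  have : y = L - l + ε * l := by rw [hy]; ring
  linarith
end

section
/- Let n ≥ 1 be an integer and let α > 0 be a real number with α(α+1)^n = 2. Let σ and s be real numbers with 0 < σ ≤ s, and set t = s + ασ. Then t^n (t − σ) ≥ s^n (s + σ). -/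
lemma aux_pow (n : ℕ) (hn : 1 ≤ n) : (1 + 2 / ((n:ℝ) + 1)) ^ n ≤ n + 1 := by
  by_cases h : n ≤ 4
  · interval_cases n <;> norm_num
  · have h5 : (5:ℝ) ≤ n := by exact_mod_cast (by omega : 5 ≤ n)
    have hp : (0:ℝ) < (n:ℝ) + 1 := by positivity
    have h1 : (1 + 2 / ((n:ℝ) + 1)) ^ (n+1) ≤ Real.exp 2 := by
      have := Real.add_one_le_exp (2 / ((n:ℝ) + 1))
      calc (1 + 2 / ((n:ℝ) + 1)) ^ (n+1) ≤ (Real.exp (2 / ((n:ℝ) + 1))) ^ (n+1) := by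
            apply pow_le_pow_left₀ (by positivity); linarith
        _ = Real.exp 2 := by
            rw [← Real.exp_nat_mul]; congr 1; push_cast; field_simp
    have h2 : Real.exp 2 ≤ 8 := by
      have h3 := Real.exp_one_lt_d9
      have h4 : Real.exp 2 = Real.exp 1 * Real.exp 1 := by rw [← Real.exp_add]; norm_num
      have := Real.exp_pos 1
      rw [h4]; nlinarith
    rw [pow_succ] at h1
    have h6 : (1 + 2 / ((n:ℝ) + 1)) = (n + 3) / (n+1) := by field_simp; ring
    have h7 : (1 + 2 / ((n:ℝ) + 1)) ^ n * ((n + 3) / (n+1)) ≤ 8 := by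
      rw [← h6]; linarith
    rw [mul_div_assoc', div_le_iff₀ hp] at h7
    have h8 : (0:ℝ) ≤ (1 + 2 / ((n:ℝ) + 1)) ^ n := by positivity
    nlinarith

lemma aux_alpha (n : ℕ) (hn : 1 ≤ n) (α : ℝ) (hα : 0 < α)
    (hroot : α * (α + 1) ^ n = 2) : 2 ≤ (n + 1) * α := by
  by_contra! hc
  have hp : (0:ℝ) < (n:ℝ) + 1 := by positivity
  have hb : α < 2 / ((n:ℝ) + 1) := by rw [lt_div_iff₀ hp]; linarith
  have h1 : (α + 1) ^ n ≤ (1 + 2 / ((n:ℝ) + 1)) ^ n :=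
    pow_le_pow_left₀ (by positivity) (by linarith) n
  have h2 := h1.trans (aux_pow n hn)
  have := mul_le_mul_of_nonneg_left h2 hα.le
  linarith

lemma aux_convex (n : ℕ) (hn : 1 ≤ n) (α : ℝ) (hα : 0 < α)
    (h2 : 2 ≤ (n + 1) * α) :
    ConvexOn ℝ (Set.Icc 0 1) (fun x : ℝ => (1 + x) * ((1 + α * x) ^ n)⁻¹) := by
  have hn' : (1:ℝ) ≤ n := by exact_mod_cast hn
  obtain ⟨k, rfl⟩ : ∃ k, n = k + 1 := ⟨n - 1, by omega⟩
  have hu : ∀ x ∈ Set.Icc (0:ℝ) 1, 0 < 1 + α * x := fun x hx => by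
    have := hx.1; positivity
  have hd0 : ∀ x : ℝ, HasDerivAt (fun x : ℝ => 1 + α * x) α x := fun x => by
    simpa using ((hasDerivAt_id x).const_mul α).const_add 1
  have hdp : ∀ m : ℕ, ∀ x ∈ Set.Icc (0:ℝ) 1, HasDerivAt (fun x : ℝ => ((1 + α * x) ^ (m+1))⁻¹)
      (-((m+1) * α) * ((1 + α * x) ^ (m+2))⁻¹) x := fun m x hx => by
    have hx' := hu x hx
    have hne : (1 + α * x) ^ (m+1) ≠ 0 := by positivity
    have := ((hd0 x).pow (m+1)).inv hne
    refine HasDerivAt.congr_deriv this ?_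
    simp only [Pi.pow_apply, Nat.add_sub_cancel]
    push_cast
    field_simp
    ring
  have hd1 : ∀ x ∈ Set.Icc (0:ℝ) 1,
      HasDerivAt (fun x : ℝ => (1 + x) * ((1 + α * x) ^ (k+1))⁻¹)
      (((1 + α * x) ^ (k+1))⁻¹ + (1 + x) * (-((k+1) * α) * ((1 + α * x) ^ (k+2))⁻¹)) x :=
    fun x hx => by
      refine HasDerivAt.congr_deriv (((hasDerivAt_id x).const_add 1).mul (hdp k x hx)) ?_
      simp
  have hd2 : ∀ x ∈ Set.Icc (0:ℝ) 1,
      HasDerivAt (fun x : ℝ => ((1 + α * x) ^ (k+1))⁻¹ +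
        (1 + x) * (-((k+1) * α) * ((1 + α * x) ^ (k+2))⁻¹))
      (-((k+1) * α) * ((1 + α * x) ^ (k+2))⁻¹ + (-((k+1) * α) * ((1 + α * x) ^ (k+2))⁻¹ +
        (1 + x) * (-((k+1) * α) * (-((k+1+1) * α) * ((1 + α * x) ^ (k+3))⁻¹)))) x :=
    fun x hx => by
      have := (hdp k x hx).add
        (((hasDerivAt_id x).const_add 1).mul ((hdp (k+1) x hx).const_mul (-((k+1) * α))))
      refine HasDerivAt.congr_deriv this ?_
      simp
  refine convexOn_of_hasDerivWithinAt2_nonneg (convex_Icc 0 1)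
    (fun x hx => (hd1 x hx).continuousAt.continuousWithinAt)
    (fun x hx => (hd1 x (interior_subset hx)).hasDerivWithinAt)
    (fun x hx => (hd2 x (interior_subset hx)).hasDerivWithinAt) ?_
  intro x hx
  have hx := interior_subset hx
  have hx' := hu x hx
  have e : (-((k+1) * α) * ((1 + α * x) ^ (k+2))⁻¹ + (-((k+1) * α) * ((1 + α * x) ^ (k+2))⁻¹ +
        (1 + x) * (-((k+1) * α) * (-((k+1+1) * α) * ((1 + α * x) ^ (k+3))⁻¹)))) =
      (k+1) * α * ((1 + α * x) ^ (k+3))⁻¹ * (((k+2) * α - 2) + k * (α * x)) := by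
    field_simp
    ring
  rw [e]
  have h3 : 0 ≤ ((k:ℝ)+2) * α - 2 := by push_cast at h2; linarith
  have := hx.1
  positivity

theorem pow_mul_sub_ge (n : ℕ) (hn : 1 ≤ n) (α : ℝ) (hα : 0 < α)
    (hroot : α * (α + 1) ^ n = 2)
    (σ s : ℝ) (hσ : 0 < σ) (hσs : σ ≤ s) (t : ℝ) (ht : t = s + α * σ) :
    t ^ n * (t - σ) ≥ s ^ n * (s + σ) := by
  have hs : 0 < s := by linarith
  obtain ⟨x, hx⟩ : ∃ x, x = σ / s := ⟨_, rfl⟩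
  have hx0 : 0 < x := by rw [hx]; positivity
  have hx1 : x ≤ 1 := by rw [hx, div_le_one hs]; exact hσs
  have hσx : σ = s * x := by rw [hx]; field_simp
  have hc := (aux_convex n hn α hα (aux_alpha n hn α hα hroot)).2
    (Set.left_mem_Icc.2 zero_le_one) (Set.right_mem_Icc.2 zero_le_one)
    (sub_nonneg.2 hx1) hx0.le (sub_add_cancel 1 x)
  have e : (1 + 1 : ℝ) * ((1 + α * 1) ^ n)⁻¹ = α := by
    have : (α + 1) ^ n ≠ 0 := by positivity
    rw [mul_one, add_comm 1 α, ← div_eq_mul_inv, div_eq_iff this]; linarith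
  simp only [smul_eq_mul, e] at hc
  simp only [mul_zero, zero_add, mul_one, add_zero, one_pow, inv_one] at hc
  have hp : 0 < (1 + α * x) ^ n := by positivity
  rw [← div_eq_mul_inv, div_le_iff₀ hp] at hc
  have ht' : t = s * (1 + α * x) := by rw [ht, hσx]; ring
  rw [ht', hσx, mul_pow]
  have := mul_le_mul_of_nonneg_left hc (by positivity : 0 ≤ s ^ n * s)
  nlinarith
end

section
/- Let n ≥ 5 be an odd integer and let α > 0 be the positive real root of x(x+1)^n = 2. Let σ and s be real numbers with 0 < σ ≤ s, set t = s + ασ, and let k be an integer with 1 ≤ k ≤ (n−3)/2. Then (t/s)^{n−2k} ≥ (s + σ/(2k)) / (t − σ/(2k)). -/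
theorem aux_root_ge (n : ℕ) (hn : 7 ≤ n) (hodd : Odd n) (α : ℝ) (hα : 0 < α)
    (hroot : α * (α + 1) ^ n = 2) : 2 ≤ α * n := by
  by_contra! h
  rcases Nat.lt_or_ge n 8 with h8 | h8
  · have : n = 7 := by omega
    subst this
    have h1 : α < 2 / 7 := by push_cast at h; linarith
    have h2 : (α + 1) ^ 7 ≤ (2 / 7 + 1) ^ 7 := by gcongr
    have h3 : α * (α + 1) ^ 7 ≤ (2 / 7) * (2 / 7 + 1) ^ 7 := by gcongr
    rw [hroot] at h3
    norm_num at h3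
  · have hn8 : (8 : ℝ) ≤ n := by exact_mod_cast h8
    have ha : α < 1 / 4 := by nlinarith
    have h1 : (α + 1) ^ n ≤ Real.exp 2 := by
      calc (α + 1) ^ n ≤ (Real.exp α) ^ n := by
            gcongr
            exact Real.add_one_le_exp α
        _ = Real.exp (n * α) := by rw [Real.exp_nat_mul]
        _ ≤ Real.exp 2 := by
            apply Real.exp_le_exp.mpr
            linarith
    have h2 : Real.exp 2 < 8 := by
      have : Real.exp 2 = Real.exp 1 * Real.exp 1 := by rw [← Real.exp_add]; norm_num
      have h3 := Real.exp_one_lt_d9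
      have h4 := Real.exp_pos 1
      rw [this]; nlinarith
    nlinarith

theorem aux_key (n : ℕ) (hn : 5 ≤ n) (hodd : Odd n) (α : ℝ) (hα : 0 < α)
    (hroot : α * (α + 1) ^ n = 2) (k m : ℕ) (hk1 : 1 ≤ k) (hm : 3 ≤ m) (hmn : n = m + 2 * k) :
    1 ≤ α * (m * (k - 1 / 2) + k) + m * k * α ^ 2 := by
  have hK : (1 : ℝ) ≤ k := by exact_mod_cast hk1
  have hM : (3 : ℝ) ≤ m := by exact_mod_cast hm
  rcases Nat.lt_or_ge n 7 with h7 | h7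
  · have hk : k = 1 := by omega
    have hm : m = 3 := by
      obtain ⟨j, hj⟩ := hodd
      omega
    subst hk hm
    subst hmn
    have : 9 / 25 ≤ α := by
      by_contra! h
      have h2 : (α + 1) ^ 5 ≤ (9 / 25 + 1) ^ 5 := by gcongr
      have h3 : α * (α + 1) ^ 5 ≤ (9 / 25) * (9 / 25 + 1) ^ 5 := by gcongr
      norm_num at hroot
      rw [hroot] at h3
      norm_num at h3
    push_cast
    nlinarith
  · have h := aux_root_ge n h7 hodd α hα hroot
    rw [hmn] at h
    push_cast at h
    have h1 : 0 ≤ (m : ℝ) * k * α ^ 2 := by positivity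
    have h2 : 0 ≤ α * m * (k - 1) := mul_nonneg (by positivity) (by linarith)
    nlinarith

theorem ratio_pow_ge (n : ℕ) (hn : 5 ≤ n) (hodd : Odd n) (α : ℝ) (hα : 0 < α)
    (hroot : α * (α + 1) ^ n = 2)
    (σ s : ℝ) (hσ : 0 < σ) (hσs : σ ≤ s) (t : ℝ) (ht : t = s + α * σ)
    (k : ℕ) (hk1 : 1 ≤ k) (hk2 : k ≤ (n - 3) / 2) :
    (t / s) ^ (n - 2 * k) ≥ (s + σ / (2 * k)) / (t - σ / (2 * k)) := by
  obtain ⟨m, hm⟩ : ∃ m, m = n - 2 * k := ⟨_, rfl⟩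
  rw [← hm]
  have hm3 : 3 ≤ m := by omega
  have key := aux_key n hn hodd α hα hroot k m hk1 hm3 (by omega)
  have hs : 0 < s := by linarith
  have hK : (1 : ℝ) ≤ k := by exact_mod_cast hk1
  have hM : (3 : ℝ) ≤ m := by exact_mod_cast hm3
  obtain ⟨c, hc⟩ : ∃ c : ℝ, c = 1 / (2 * k) := ⟨_, rfl⟩
  have hkc : 2 * k * c = 1 := by rw [hc]; field_simp
  have hc0 : 0 < c := by rw [hc]; positivity
  have hc2 : c ≤ 1 / 2 := by nlinarith
  obtain ⟨x, hx⟩ : ∃ x : ℝ, x = σ / s := ⟨_, rfl⟩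
  have hx0 : 0 < x := by rw [hx]; positivity
  have hx1 : x ≤ 1 := by rw [hx]; exact (div_le_one hs).mpr hσs
  have hσx : σ = x * s := by rw [hx]; field_simp
  have e1 : σ / (2 * k) = c * x * s := by rw [hc, hσx]; ring
  have e2 : t / s = 1 + α * x := by rw [ht, hσx]; field_simp
  have hcx : c * x ≤ 1 / 2 := by nlinarith
  have hax : 0 < α * x := by positivity
  have hden : 0 < 1 + (α - c) * x := by nlinarith
  have e3 : (s + σ / (2 * k)) / (t - σ / (2 * k)) = (1 + c * x) / (1 + (α - c) * x) := by
    rw [e1, ht, hσx, show s + c * x * s = (1 + c * x) * s by ring,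
      show s + α * (x * s) - c * x * s = (1 + (α - c) * x) * s by ring,
      mul_div_mul_right _ _ hs.ne']
  rw [e2, e3, ge_iff_le, div_le_iff₀ hden]
  have bern : 1 + m * (α * x) ≤ (1 + α * x) ^ m :=
    one_add_mul_le_pow (by linarith) m
  -- the endpoint inequality at x = 1
  have end1 : 0 ≤ (m + 1) * α - 2 * c + m * α * (α - c) := by
    have : 2 * c * (α * (m * (k - 1 / 2) + k) + m * k * α ^ 2 - 1)
        = (m + 1) * α - 2 * c + m * α * (α - c) := by
      linear_combination (α * m + α + m * α ^ 2) * hkc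
    rw [← this]
    exact mul_nonneg (by positivity) (by linarith)
  have mid : 0 ≤ (m + 1) * α - 2 * c + m * α * (α - c) * x := by
    rcases le_total c α with h | h
    · have h1 : 0 ≤ m * α * (α - c) * x :=
        mul_nonneg (mul_nonneg (by positivity) (by linarith)) hx0.le
      nlinarith
    · have h1 : 0 ≤ m * α * (c - α) * (1 - x) :=
        mul_nonneg (mul_nonneg (by positivity) (by linarith)) (by linarith)
      nlinarith
  calc 1 + c * x ≤ (1 + m * (α * x)) * (1 + (α - c) * x) := by
        have := mul_nonneg hx0.le mid
        linarith
    _ ≤ _ := by gcongr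
end

section
/- Suppose n ≥ 3 is odd, d is an integer with d ≥ σ_1(ω) + 1, and α > 0 is the positive real root of x(x+1)^n = 2. Then Ψ(d − 1 + α·σ_1(ω)) > Σ_{l=0}^{n} (d−1)^{n−l} σ_l(ω). -/
lemma aux_prod {N : ℕ} (ω : Fin N → ℕ) (x : ℝ) :
    ∏ i, ((ω i : ℝ) + x) = ∑ l ∈ Finset.range (N + 1), esym ω l * x ^ (N - l) := by
  rw [Finset.prod_add, Finset.sum_powerset]
  simp only [Finset.card_univ, Fintype.card_fin]
  refine Finset.sum_congr rfl fun l hl => ?_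
  rw [esym, Finset.sum_mul]
  refine Finset.sum_congr rfl fun A hA => ?_
  rw [Finset.mem_powersetCard] at hA
  rw [Finset.prod_const, Finset.card_sdiff_of_subset hA.1, hA.2]
  simp

lemma aux_one {N : ℕ} (ω : Fin N → ℕ) : esym ω 1 = ∑ i, (ω i : ℝ) := by
  simp [esym, Finset.powersetCard_one]

lemma aux_S (e : ℕ → ℝ) (x : ℝ) (n : ℕ) :
    ∑ l ∈ Finset.range (n + 2), e l * x ^ (n + 1 - l)
      = x * (∑ l ∈ Finset.range (n + 1), e l * x ^ (n - l)) + e (n + 1) := by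
  rw [Finset.sum_range_succ, Finset.mul_sum]
  congr 1
  · refine Finset.sum_congr rfl fun l hl => ?_
    rw [Finset.mem_range] at hl
    rw [show n + 1 - l = (n - l) + 1 by omega]
    ring
  · simp

lemma aux_B (e : ℕ → ℝ) (t : ℝ) (n : ℕ) :
    ∑ k ∈ Finset.range (n + 1), (-1 : ℝ) ^ k * e (n - k) * t ^ (k + 1)
      = t * ∑ l ∈ Finset.range (n + 1), e l * (-t) ^ (n - l) := by
  rw [← Finset.sum_range_reflect, Finset.mul_sum]
  refine Finset.sum_congr rfl fun l hl => ?_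
  rw [Finset.mem_range] at hl
  rw [show n + 1 - 1 - l = n - l by omega, show n - (n - l) = l by omega, neg_pow t]
  ring

lemma aux_A (e : ℕ → ℝ) (t D : ℝ) (n : ℕ) :
    (D + t) * ∑ j ∈ Finset.range n,
      (∑ k ∈ Finset.range (j + 1), (-1 : ℝ) ^ k * e (j - k) * t ^ (k + 1)) * D ^ (n - 1 - j)
      = t * ((∑ l ∈ Finset.range (n + 1), e l * D ^ (n - l))
        - ∑ l ∈ Finset.range (n + 1), e l * (-t) ^ (n - l)) := by
  induction n with
  | zero => simp
  | succ n ih =>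
    rw [aux_S, aux_S, Finset.sum_range_succ, aux_B]
    have : ∑ j ∈ Finset.range n,
      (∑ k ∈ Finset.range (j + 1), (-1 : ℝ) ^ k * e (j - k) * t ^ (k + 1)) * D ^ (n + 1 - 1 - j)
      = D * ∑ j ∈ Finset.range n,
      (∑ k ∈ Finset.range (j + 1), (-1 : ℝ) ^ k * e (j - k) * t ^ (k + 1)) * D ^ (n - 1 - j) := by
      rw [Finset.mul_sum]
      refine Finset.sum_congr rfl fun l hl => ?_
      rw [Finset.mem_range] at hl
      rw [show n + 1 - 1 - l = (n - 1 - l) + 1 by omega]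
      ring
    rw [this]
    simp only [Nat.add_sub_cancel, Nat.sub_self, pow_zero]
    linear_combination D * ih

lemma aux_base_id (n : ℕ) (α u : ℝ) :
    (1 + α * u) ^ n * (1 - (1 - α) * u) - (1 + u)
      = u * ∑ k ∈ Finset.range (n + 1),
        ((n.choose (k + 1) * α ^ (k + 1) - (1 - α) * (n.choose k * α ^ k))
          - if k = 0 then 1 else 0) * u ^ k := by
  have h1 : (1 + α * u) ^ n = ∑ k ∈ Finset.range (n + 1), (n.choose k * α ^ k) * u ^ k := by
    rw [add_comm, add_pow]
    refine Finset.sum_congr rfl fun l hl => ?_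
    rw [mul_pow]; ring
  have h2 : (1 + α * u) ^ n
      = 1 + u * ∑ k ∈ Finset.range (n + 1), (n.choose (k + 1) * α ^ (k + 1)) * u ^ k := by
    have := Finset.sum_range_succ (fun k => ((n.choose k : ℝ) * α ^ k) * u ^ k) (n + 1)
    rw [← h1, Finset.sum_range_succ'] at this
    simp only [Nat.choose_succ_self, Nat.cast_zero, zero_mul, add_zero, Nat.choose_zero_right,
      pow_zero, Nat.cast_one, mul_one] at this
    rw [← this, add_comm, Finset.mul_sum]
    congr 1
    refine Finset.sum_congr rfl fun l hl => ?_
    ring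
  have h3 : ∑ k ∈ Finset.range (n + 1), (if k = 0 then (1 : ℝ) else 0) * u ^ k = 1 := by
    rw [Finset.sum_range_succ']; simp
  simp only [sub_mul, Finset.sum_sub_distrib]
  rw [h3]
  have h4 : ∑ k ∈ Finset.range (n + 1), (1 - α) * (n.choose k * α ^ k) * u ^ k
      = (1 - α) * (1 + α * u) ^ n := by
    rw [h1, Finset.mul_sum]
    refine Finset.sum_congr rfl fun l hl => ?_
    ring
  simp only [sub_mul, Finset.sum_sub_distrib] at h4
  rw [h4]
  linear_combination h2

lemma aux_sum (n K : ℕ) (c : ℕ → ℝ) (u : ℝ) (hu : 0 ≤ u) (hu1 : u ≤ 1)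
    (h1 : ∀ k < K, 0 ≤ c k) (h2 : ∀ k, K ≤ k → c k ≤ 0)
    (h0 : ∑ k ∈ Finset.range n, c k = 0) : 0 ≤ ∑ k ∈ Finset.range n, c k * u ^ k := by
  calc (0 : ℝ) = ∑ k ∈ Finset.range n, c k * u ^ K := by rw [← Finset.sum_mul, h0, zero_mul]
    _ ≤ _ := by
      refine Finset.sum_le_sum fun k _ => ?_
      rcases lt_or_ge k K with h | h
      · exact mul_le_mul_of_nonneg_left (pow_le_pow_of_le_one hu hu1 h.le) (h1 k h)
      · exact mul_le_mul_of_nonpos_left (pow_le_pow_of_le_one hu hu1 h) (h2 k h)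

lemma aux_base (n : ℕ) (α u : ℝ) (hα : 0 < α) (hroot : α * (α + 1) ^ n = 2)
    (hu : 0 ≤ u) (hu1 : u ≤ 1) :
    1 + u ≤ (1 + α * u) ^ n * (1 + α * u - u) := by
  set c : ℕ → ℝ := fun k => (n.choose (k + 1) * α ^ (k + 1) - (1 - α) * (n.choose k * α ^ k))
          - if k = 0 then 1 else 0 with hc
  have key : ∀ k : ℕ, ((k : ℝ) + 1) * (n.choose (k + 1) * α ^ (k + 1) - (1 - α) * (n.choose k * α ^ k))
      = n.choose k * α ^ k * ((n + 1) * α - (k + 1)) := by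
    intro k
    have h := Nat.choose_succ_right_eq n k
    have h' : (n.choose (k + 1) : ℝ) * (k + 1) = n.choose k * (n - k) := by
      rcases le_or_gt k n with hk | hk
      · have := congrArg (Nat.cast : ℕ → ℝ) h
        push_cast [Nat.cast_sub hk] at this
        exact this
      · rw [Nat.choose_eq_zero_of_lt hk, Nat.choose_eq_zero_of_lt (by omega)]; simp
    linear_combination α ^ (k + 1) * h'
  have hc0 : c 0 = (n + 1) * α - 2 := by simp [hc]; ring
  have hpos : ∀ k : ℕ, 1 ≤ k → (k + 1 : ℝ) ≤ (n + 1) * α → 0 ≤ c k := by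
    intro k hk hle
    have : c k = (n.choose (k + 1) * α ^ (k + 1) - (1 - α) * (n.choose k * α ^ k)) := by
      simp [hc]; omega
    rw [this]
    refine nonneg_of_mul_nonneg_right (a := (k : ℝ) + 1) ?_ (by positivity)
    rw [key]
    exact mul_nonneg (by positivity) (by linarith)
  have hneg : ∀ k : ℕ, 1 ≤ k → (n + 1) * α ≤ (k + 1 : ℝ) → c k ≤ 0 := by
    intro k hk hle
    have : c k = (n.choose (k + 1) * α ^ (k + 1) - (1 - α) * (n.choose k * α ^ k)) := by
      simp [hc]; omega
    rw [this]
    refine nonpos_of_mul_nonpos_right (a := (k : ℝ) + 1) ?_ (by positivity)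
    rw [key]
    exact mul_nonpos_of_nonneg_of_nonpos (by positivity) (by linarith)
  have h0 : ∑ k ∈ Finset.range (n + 1), c k = 0 := by
    have := aux_base_id n α 1
    simp only [one_pow, mul_one, one_mul] at this
    rw [hc, ← this]
    have h5 : α * (1 + α) ^ n = 2 := by rw [← hroot, add_comm 1 α]
    linear_combination h5
  have hs : 0 ≤ ∑ k ∈ Finset.range (n + 1), c k * u ^ k := by
    rcases lt_or_ge ((n + 1) * α) 2 with h | h
    · refine aux_sum _ 0 c u hu hu1 (by intro k hk; omega) ?_ h0
      intro k _
      rcases Nat.eq_zero_or_pos k with rfl | hk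
      · rw [hc0]; linarith
      · have : (1 : ℝ) ≤ k := by exact_mod_cast hk
        exact hneg k hk (by linarith)
    · refine aux_sum _ ⌊(n + 1) * α⌋₊ c u hu hu1 ?_ ?_ h0
      · intro k hk
        rcases Nat.eq_zero_or_pos k with rfl | hk0
        · rw [hc0]; linarith
        · refine hpos k hk0 ?_
          have : ((k + 1 : ℕ) : ℝ) ≤ (n + 1) * α :=
            (Nat.le_floor_iff (by positivity)).1 hk
          exact_mod_cast this
      · intro k hk
        have h2 : 2 ≤ ⌊(n + 1) * α⌋₊ := Nat.le_floor (by exact_mod_cast h)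
        refine hneg k (by omega) ?_
        have := Nat.lt_floor_add_one ((n + 1) * α)
        have hk' : (⌊(n + 1) * α⌋₊ : ℝ) ≤ k := by exact_mod_cast hk
        linarith
  have := aux_base_id n α u
  have h6 := mul_nonneg hu hs
  rw [← this] at h6
  linarith [h6, show 1 - (1 - α) * u = 1 + α * u - u by ring,
    show (1 + α * u) ^ n * (1 - (1 - α) * u) = (1 + α * u) ^ n * (1 + α * u - u) by ring]

lemma aux_base' (n : ℕ) (α s D : ℝ) (hα : 0 < α) (hroot : α * (α + 1) ^ n = 2)
    (hs : 0 < s) (hD : s ≤ D) :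
    D ^ n * (D + s) ≤ (D + α * s) ^ n * (D + α * s - s) := by
  have hD0 : 0 < D := by linarith
  have h := aux_base n α (s / D) hα hroot (by positivity) ((div_le_one hD0).2 hD)
  have h2 := mul_le_mul_of_nonneg_left h (by positivity : 0 ≤ D ^ n * D)
  have e1 : D ^ n * D * (1 + s / D) = D ^ n * (D + s) := by field_simp
  have e2 : D * (1 + α * (s / D)) = D + α * s := by field_simp
  have e3 : D * (1 + α * (s / D) - s / D) = D + α * s - s := by field_simp
  rw [e1] at h2
  rw [← e3, ← e2, mul_pow]
  linarith

/-- merging step -/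
lemma aux_step (t D v y : ℝ) (hv : 0 < v) (hy : 0 < y)
    (h : t * (t - (v + y)) ≤ D * (D + (v + y))) :
    (D + v) * (D + y) * (t * (t - (v + y))) ≤ (t - v) * (t - y) * (D * (D + (v + y))) := by
  nlinarith [mul_nonneg (mul_pos hv hy).le (sub_nonneg.2 h)]

lemma aux_step' (t D v y : ℝ) (hv : 0 < v) (hy : 0 < y)
    (h : t * (t - (v + y)) < D * (D + (v + y))) :
    (D + v) * (D + y) * (t * (t - (v + y))) < (t - v) * (t - y) * (D * (D + (v + y))) := by
  nlinarith [mul_pos (mul_pos hv hy) (sub_pos.2 h)]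

lemma aux_merge {ι : Type*} [DecidableEq ι] (x : ι → ℝ) (hx : ∀ i, 0 < x i) (t D : ℝ)
    (hD : 0 < D) (ht : 0 < t) (T : Finset ι) : ∀ v, 0 < v → t * (t - v) ≤ D * (D + v) →
    v + ∑ i ∈ T, x i < t →
    ((D + v) * ∏ i ∈ T, (D + x i)) * (t ^ T.card * (t - (v + ∑ i ∈ T, x i)))
      ≤ ((t - v) * ∏ i ∈ T, (t - x i)) * (D ^ T.card * (D + (v + ∑ i ∈ T, x i))) ∧
    (T.Nonempty →
    ((D + v) * ∏ i ∈ T, (D + x i)) * (t ^ T.card * (t - (v + ∑ i ∈ T, x i)))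
      < ((t - v) * ∏ i ∈ T, (t - x i)) * (D ^ T.card * (D + (v + ∑ i ∈ T, x i)))) := by
  induction T using Finset.induction_on with
  | empty => intro v _ _ _; simp; linarith [mul_comm (D + v) (t - v)]
  | insert j T hj ih =>
    intro v hv h hlt
    rw [Finset.sum_insert hj] at hlt
    rw [Finset.sum_insert hj, Finset.prod_insert hj, Finset.prod_insert hj,
      Finset.card_insert_of_notMem hj]
    have hy := hx j
    set y := x j
    have hS : 0 ≤ ∑ i ∈ T, x i := Finset.sum_nonneg fun i _ => (hx i).le
    have hlt' : t * (t - (v + y)) < D * (D + (v + y)) := by nlinarith [mul_pos ht hy, mul_pos hD hy]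
    have ih' := (ih (v + y) (by linarith) hlt'.le (by linarith)).1
    have st := aux_step' t D v y hv hy hlt'
    rw [← add_assoc]
    set S := ∑ i ∈ T, x i
    have hPD : 0 < ∏ i ∈ T, (D + x i) :=
      Finset.prod_pos fun i _ => by linarith [hx i]
    have hPt : 0 < ∏ i ∈ T, (t - x i) := Finset.prod_pos fun i hi => by
      have := Finset.single_le_sum (f := x) (fun i _ => (hx i).le) hi
      linarith
    set PD := ∏ i ∈ T, (D + x i)
    set Pt := ∏ i ∈ T, (t - x i)
    have htv : 0 < t - (v + y) := by linarith
    have hDv : 0 < D + (v + y) := by linarith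
    have hE : 0 < t ^ T.card * (t - (v + y + S)) := mul_pos (by positivity) (by linarith)
    have hm := mul_lt_mul_of_pos_right st (mul_pos (mul_pos hDv hPD) hE)
    have hR : 0 < (t - v) * (t - y) * (D * (D + (v + y))) := by
      have : 0 < t - v := by linarith
      have : 0 < t - y := by linarith
      positivity
    have hm2 := mul_le_mul_of_nonneg_left ih' hR.le
    have hcomb : ((t - (v + y)) * (D + (v + y))) *
        (((D + v) * ((D + y) * PD)) * (t ^ (T.card + 1) * (t - (v + y + S))))
        < ((t - (v + y)) * (D + (v + y))) *
        (((t - v) * ((t - y) * Pt)) * (D ^ (T.card + 1) * (D + (v + y + S)))) := by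
      have e1 := hm.trans_le hm2
      rw [pow_succ t, pow_succ D]
      calc _ = _ := by ring
        _ < _ := e1
        _ = _ := by ring
    have := lt_of_mul_lt_mul_left hcomb (mul_pos htv hDv).le
    exact ⟨this.le, fun _ => this⟩

lemma aux_pairs (n : ℕ) (hn : 1 ≤ n) (x : Fin (n + 1) → ℝ) (hx : ∀ i, 0 < x i) (t D : ℝ)
    (hD : 0 < D) (hxt : ∀ i, x i < t)
    (h : ∀ i j, i ≠ j → D * (D + (x i + x j)) < t * (t - (x i + x j))) :
    ∏ i, (D + x i) < ∏ i, (t - x i) := by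
  have hne : ∀ i : Fin (n + 1), i ≠ i + 1 := by
    intro i hi
    have h1 : (1 : Fin (n + 1)) = 0 := by
      have : i + 0 = i + 1 := by simpa using hi
      exact (add_left_cancel this).symm
    have h2 := congrArg Fin.val h1
    rw [Fin.val_one', Fin.val_zero, Nat.mod_eq_of_lt (by omega)] at h2
    omega
  have key : ∏ i, ((D + x i) * (D + x (i + 1))) < ∏ i, ((t - x i) * (t - x (i + 1))) := by
    refine Finset.prod_lt_prod_of_nonempty (fun i _ => ?_) (fun i _ => ?_) Finset.univ_nonempty
    · have := hx i
      have := hx (i + 1)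
      positivity
    · have := h i (i + 1) (hne i)
      nlinarith
  have p1 : ∏ i, (D + x (i + 1)) = ∏ i, (D + x i) :=
    Equiv.prod_comp (Equiv.addRight (1 : Fin (n + 1))) (fun i => D + x i)
  have p2 : ∏ i, (t - x (i + 1)) = ∏ i, (t - x i) :=
    Equiv.prod_comp (Equiv.addRight (1 : Fin (n + 1))) (fun i => t - x i)
  rw [Finset.prod_mul_distrib, Finset.prod_mul_distrib, p1, p2] at key
  have hp : 0 ≤ ∏ i, (t - x i) := Finset.prod_nonneg fun i _ => by linarith [hxt i]
  exact lt_of_mul_self_lt_mul_self₀ hp key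

lemma aux_main (n : ℕ) (hn : 3 ≤ n) (x : Fin (n + 1) → ℝ) (hx : ∀ i, 0 < x i) (t D : ℝ)
    (hD : 0 < D) (hxt : ∑ i, x i < t)
    (hb : D ^ n * (D + ∑ i, x i) ≤ t ^ n * (t - ∑ i, x i)) :
    ∏ i, (D + x i) < ∏ i, (t - x i) := by
  have hle : ∀ i, x i ≤ ∑ i, x i := fun i =>
    Finset.single_le_sum (f := x) (fun i _ => (hx i).le) (Finset.mem_univ i)
  by_cases h : ∀ i j, i ≠ j → D * (D + (x i + x j)) < t * (t - (x i + x j))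
  · exact aux_pairs n (by omega) x hx t D hD (fun i => (hle i).trans_lt hxt) h
  push Not at h
  obtain ⟨i, j, hij, hv⟩ := h
  have ht : 0 < t := by linarith [hx i, hle i]
  set T : Finset (Fin (n + 1)) := (Finset.univ.erase i).erase j with hT
  have hji : j ∈ Finset.univ.erase i := by simp [hij.symm]
  have hcard : T.card + 1 = n := by
    rw [hT, Finset.card_erase_of_mem hji, Finset.card_erase_of_mem (Finset.mem_univ i)]
    simp; omega
  have hsum : ∑ i, x i = x i + x j + ∑ k ∈ T, x k := by
    rw [← Finset.add_sum_erase _ _ (Finset.mem_univ i), ← Finset.add_sum_erase _ _ hji, add_assoc]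
  have hprod : ∀ f : Fin (n + 1) → ℝ, ∏ i, f i = f i * f j * ∏ k ∈ T, f k := by
    intro f
    rw [← Finset.mul_prod_erase _ _ (Finset.mem_univ i), ← Finset.mul_prod_erase _ _ hji, mul_assoc]
  have hTn : T.Nonempty := Finset.card_pos.1 (by omega)
  have hi := hx i
  have hj := hx j
  have hm := (aux_merge x hx t D hD ht T (x i + x j) (by linarith) hv (by linarith)).2 hTn
  have st := aux_step t D _ _ hi hj hv
  rw [hsum] at hb hxt
  rw [hprod, hprod]
  have hS : 0 < ∑ i ∈ T, x i := Finset.sum_pos (fun i _ => hx i) hTn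
  have hPD : 0 < ∏ i ∈ T, (D + x i) :=
    Finset.prod_pos fun i _ => by linarith [hx i]
  set S := ∑ k ∈ T, x k
  set PD := ∏ i ∈ T, (D + x i)
  set Pt := ∏ i ∈ T, (t - x i)
  set v := x i + x j
  have hvp : 0 < v := by positivity
  have htv : 0 < t - v := by linarith
  have hR : 0 < (t - x i) * (t - x j) * (D * (D + v)) := by
    have : 0 < t - x i := by linarith
    have : 0 < t - x j := by linarith
    positivity
  have hE : 0 < t ^ T.card * (t - (v + S)) := mul_pos (by positivity) (by linarith)
  have hm1 := mul_le_mul_of_nonneg_right st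
    (mul_pos (mul_pos (by linarith : 0 < D + v) hPD) hE).le
  have hm2 := mul_lt_mul_of_pos_left hm hR
  have e1 := hm1.trans_lt hm2
  rw [← hcard, pow_succ, pow_succ] at hb
  have hF : 0 < D ^ T.card * D * (D + (v + S)) := by positivity
  have hlast : ((t - v) * (D + v) * (D ^ T.card * D * (D + (v + S)))) *
      ((D + x i) * (D + x j) * PD)
      < ((t - v) * (D + v) * (D ^ T.card * D * (D + (v + S)))) *
      ((t - x i) * (t - x j) * Pt) := by
    calc _ = ((t - v) * (D + v) * ((D + x i) * (D + x j) * PD)) *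
          (D ^ T.card * D * (D + (v + S))) := by ring
      _ ≤ ((t - v) * (D + v) * ((D + x i) * (D + x j) * PD)) *
          (t ^ T.card * t * (t - (v + S))) :=
        mul_le_mul_of_nonneg_left hb (by positivity)
      _ = _ := by ring
      _ < _ := e1
      _ = _ := by ring
  exact lt_of_mul_lt_mul_left hlast (by positivity)

theorem Psi_gt_sum_of_odd (n : ℕ) (hn : 3 ≤ n) (hodd : Odd n)
    (ω : Fin (n + 1) → ℕ) (hω : ∀ i, 0 < ω i)
    (d : ℤ) (hd : (d : ℝ) ≥ esym ω 1 + 1)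
    (α : ℝ) (hα : 0 < α) (hroot : α * (α + 1) ^ n = 2) :
    Psi n ω d ((d : ℝ) - 1 + α * esym ω 1)
      > ∑ l ∈ Finset.range (n + 1), ((d : ℝ) - 1) ^ (n - l) * esym ω l := by
  rw [aux_one] at hd ⊢
  set s := ∑ i, (ω i : ℝ) with hs
  set D := (d : ℝ) - 1 with hDd
  set t := D + α * s with ht
  have hω' : ∀ i, (0 : ℝ) < ω i := fun i => by exact_mod_cast hω i
  have hs0 : 0 < s := Finset.sum_pos (fun i _ => hω' i) Finset.univ_nonempty
  have hsD : s ≤ D := by rw [hDd]; linarith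
  have hαs : 0 < α * s := mul_pos hα hs0
  have hmain := aux_main n hn (fun i => (ω i : ℝ)) hω' t D (by linarith) (by linarith)
    (aux_base' n α s D hα hroot hs0 hsD)
  have hA := aux_A (esym ω) t D n
  have hP : Psi n ω d t = ∑ j ∈ Finset.range n,
      (∑ k ∈ Finset.range (j + 1), (-1 : ℝ) ^ k * esym ω (j - k) * t ^ (k + 1)) *
        D ^ (n - 1 - j) := rfl
  rw [← hP] at hA
  have h1 := aux_prod ω D
  have h2 := aux_prod ω (-t)
  rw [aux_S] at h1 h2
  have h3 : ∏ i, ((ω i : ℝ) + D) = ∏ i, (D + (ω i : ℝ)) :=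
    Finset.prod_congr rfl fun i _ => add_comm _ _
  have h4 : ∏ i, ((ω i : ℝ) + -t) = ∏ i, (t - (ω i : ℝ)) := by
    have : ∀ i, (ω i : ℝ) + -t = (-1) * (t - ω i) := fun i => by ring
    simp only [this]
    rw [Finset.prod_mul_distrib, Finset.prod_const]
    simp [hodd.add_one.neg_one_pow]
  have h5 : ∑ l ∈ Finset.range (n + 1), D ^ (n - l) * esym ω l
      = ∑ l ∈ Finset.range (n + 1), esym ω l * D ^ (n - l) :=
    Finset.sum_congr rfl fun i _ => mul_comm _ _
  rw [h5]
  rw [h3] at h1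
  rw [h4] at h2
  rw [h1, h2] at hmain
  refine lt_of_mul_lt_mul_left (a := D + t) ?_ (by linarith)
  rw [hA]
  linarith
end
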